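/- Let F be the finite Fourier transform on functions A → ℂ defined by (F f)(γ) = Σ_{δ ∈ A} e(−B(γ,δ)) f(δ). Then for all (λ,μ,t) ∈ ℤ³ one has σ_β(λ,μ,t) ∘ F = F ∘ σ_β(μ,−λ,t). (This is the essential case M = S = [[0,−1],[1,0]] of the intertwining law ρ(M)⁻¹ σ_β(ζ) ρ(M) = σ_β(ζ·M) between the Schrödinger and Weil representations, since (λ,μ,t)·S = (μ,−λ,t).) -/

import Mathlib

/-- The character `e(x) = exp(2πix)` (on a choice of rational representatives of `ℚ/ℤ`). -/
noncomputable def eChar (x : ℚ) : ℂ :=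
  Complex.exp (2 * Real.pi * Complex.I * (x : ℂ))

/-- The bilinear form `B(x,y) = q(x+y) − q(x) − q(y)` (valued in representatives of `ℚ/ℤ`). -/
def Bform {A : Type} [AddCommGroup A] (q : A → ℚ) (x y : A) : ℚ :=
  q (x + y) - q x - q y

/-- The Schrödinger representation twisted at `β`:
`(σ_β(λ,μ,t) f)(γ) = e(μ·B(β, γ+λβ) + (t−λμ)·q(β)) · f(γ+λβ)`. -/
noncomputable def sigmaRep {A : Type} [AddCommGroup A] (q : A → ℚ) (β : A)
    (ζ : ℤ × ℤ × ℤ) (f : A → ℂ) : A → ℂ :=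
  fun γ =>
    eChar ((ζ.2.1 : ℚ) * Bform q β (γ + ζ.1 • β) + ((ζ.2.2 : ℚ) - (ζ.1 : ℚ) * (ζ.2.1 : ℚ)) * q β)
      * f (γ + ζ.1 • β)

/-- The finite Fourier transform `(F f)(γ) = Σ_{δ ∈ A} e(−B(γ,δ)) f(δ)`. -/
noncomputable def fourierT {A : Type} [AddCommGroup A] [Fintype A] (q : A → ℚ)
    (f : A → ℂ) : A → ℂ :=
  fun γ => ∑ δ : A, eChar (-(Bform q γ δ)) * f δ

/-- Two rationals agree in `ℚ/ℤ` exactly when they differ by an integer. -/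
theorem coe_addCircle_eq_iff_exists_int (x y : ℚ) :
    (x : AddCircle (1 : ℚ)) = y ↔ ∃ k : ℤ, x = y + k := by
  rw [QuotientAddGroup.eq_iff_sub_mem, AddSubgroup.mem_zmultiples_iff]
  simp only [zsmul_eq_mul, mul_one, eq_comm (b := x - y), sub_eq_iff_eq_add']

theorem eChar_add (x y : ℚ) : eChar (x + y) = eChar x * eChar y := by
  simp only [eChar, ← Complex.exp_add]
  push_cast
  ring_nf

theorem eChar_intCast (k : ℤ) : eChar k = 1 :=
  Complex.exp_eq_one_iff.mpr ⟨k, by push_cast; ring⟩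

/-- The character `eChar` depends only on the class of its argument in `ℚ/ℤ`. -/
theorem eChar_eq_of_coe_eq {x y : ℚ} (h : (x : AddCircle (1 : ℚ)) = y) :
    eChar x = eChar y := by
  obtain ⟨k, rfl⟩ := (coe_addCircle_eq_iff_exists_int x y).mp h
  rw [eChar_add, eChar_intCast, mul_one]

theorem coe_intCast_mul (n : ℤ) (x : ℚ) :
    (((n : ℚ) * x : ℚ) : AddCircle (1 : ℚ)) = n • (x : AddCircle (1 : ℚ)) := by
  rw [← zsmul_eq_mul, AddCircle.coe_zsmul]

theorem Bform_comm {A : Type} [AddCommGroup A] (q : A → ℚ) (x y : A) :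
    Bform q x y = Bform q y x := by
  simp only [Bform, add_comm x y]
  ring

/-- If `Bform q` is additive modulo integers in its second argument, then it is `ℤ`-linear there
modulo integers. -/
theorem coe_Bform_add_zsmul {A : Type} [AddCommGroup A] {q : A → ℚ}
    (hB : ∀ x y y' : A, ∃ k : ℤ, Bform q x (y + y') = Bform q x y + Bform q x y' + k)
    (x y z : A) (n : ℤ) :
    (Bform q x (y + n • z) : AddCircle (1 : ℚ)) =
      Bform q x y + n • (Bform q x z : AddCircle (1 : ℚ)) := by
  let b : A →+ AddCircle (1 : ℚ) := AddMonoidHom.mk' (fun y => (Bform q x y : AddCircle (1 : ℚ)))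
    fun y y' => by
      rw [← AddCircle.coe_add]
      exact (coe_addCircle_eq_iff_exists_int _ _).mpr (hB x y y')
  change b (y + n • z) = b y + n • b z
  rw [map_add, map_zsmul]

theorem coe_Bform_self {A : Type} [AddCommGroup A] {q : A → ℚ}
    (hq : ∀ (n : ℤ) (x : A), ∃ k : ℤ, q (n • x) = (n : ℚ) ^ 2 * q x + k) (x : A) :
    (Bform q x x : AddCircle (1 : ℚ)) = (2 : ℤ) • (q x : AddCircle (1 : ℚ)) := by
  rw [← coe_intCast_mul, coe_addCircle_eq_iff_exists_int]
  obtain ⟨k, hk⟩ := hq 2 x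
  refine ⟨k, ?_⟩
  rw [Bform, ← two_zsmul, hk]
  push_cast
  ring

/-- For the finite Fourier transform `F` one has `σ_β(λ,μ,t) ∘ F = F ∘ σ_β(μ,−λ,t)`:
the essential case `M = S` of the intertwining law `ρ(M)⁻¹ σ_β(ζ) ρ(M) = σ_β(ζ·M)`
between the Schrödinger and Weil representations, since `(λ,μ,t)·S = (μ,−λ,t)`. -/
theorem sigmaRep_fourier_intertwine {A : Type} [AddCommGroup A] [Fintype A]
    (q : A → ℚ) (β : A)
    (hq : ∀ (n : ℤ) (x : A), ∃ k : ℤ, q (n • x) = (n : ℚ) ^ 2 * q x + k)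
    (hB₁ : ∀ x x' y : A, ∃ k : ℤ, Bform q (x + x') y = Bform q x y + Bform q x' y + k)
    (hB₂ : ∀ x y y' : A, ∃ k : ℤ, Bform q x (y + y') = Bform q x y + Bform q x y' + k) :
    ∀ (ζ : ℤ × ℤ × ℤ) (f : A → ℂ),
      sigmaRep q β ζ (fourierT q f) = fourierT q (sigmaRep q β (ζ.2.1, -ζ.1, ζ.2.2) f) := by
  rintro ⟨l, m, t⟩ f
  funext γ
  simp only [sigmaRep, fourierT, Finset.mul_sum]
  rw [← Equiv.sum_comp (Equiv.addRight (m • β))]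
  refine Finset.sum_congr rfl fun δ _ => ?_
  simp only [Equiv.coe_addRight, ← mul_assoc, ← eChar_add]
  congr 1
  apply eChar_eq_of_coe_eq
  have hadd := coe_Bform_add_zsmul hB₂
  simp only [sub_mul, mul_assoc, AddCircle.coe_add, AddCircle.coe_sub, AddCircle.coe_neg,
    coe_intCast_mul, hadd]
  rw [Bform_comm q (γ + l • β) δ, Bform_comm q (γ + l • β) β]
  simp only [hadd, coe_Bform_self hq, Bform_comm q γ, Bform_comm q δ β]
  module
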